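/- Assume n > 2γ + 8. Then ∫_0^∞ ∫_{ℝⁿ} x_N^{1-2γ} |x̄|² W₁(x̄, x_N)² dx̄ dx_N = |S^{n-1}| · [ n(3(n-3)² + (1-4γ²)) / (3(n-4)(n-2γ-4)(n+2γ-4)) ] · A₁ B₂. -/

import Mathlib

open MeasureTheory Real Filter Topology

noncomputable section

/-- The constant `c_{n,γ}` in the definition of the standard bubble. -/
def cng (n : ℕ) (γ : ℝ) : ℝ :=
  2 ^ (((n : ℝ) - 2 * γ) / 2) *
    (Real.Gamma (((n : ℝ) + 2 * γ) / 2) / Real.Gamma (((n : ℝ) - 2 * γ) / 2)) ^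
      (((n : ℝ) - 2 * γ) / (4 * γ))

/-- The constant `p_{n,γ}` in the Poisson kernel. -/
def png (n : ℕ) (γ : ℝ) : ℝ :=
  Real.Gamma (((n : ℝ) + 2 * γ) / 2) / (Real.pi ^ ((n : ℝ) / 2) * Real.Gamma γ)

/-- The bubble `w_{λ,σ}` on `ℝⁿ`. -/
def bubble (n : ℕ) (γ lam : ℝ) (σ : EuclideanSpace ℝ (Fin n))
    (x : EuclideanSpace ℝ (Fin n)) : ℝ :=
  cng n γ * (lam / (lam ^ 2 + ‖x - σ‖ ^ 2)) ^ (((n : ℝ) - 2 * γ) / 2)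

/-- The extension `W_{λ,σ}` of the bubble to the upper half space, given by
convolution with the Poisson kernel. -/
def bubbleExt (n : ℕ) (γ lam : ℝ) (σ : EuclideanSpace ℝ (Fin n))
    (x : EuclideanSpace ℝ (Fin n)) (xN : ℝ) : ℝ :=
  png n γ * ∫ ξ : EuclideanSpace ℝ (Fin n),
    xN ^ (2 * γ) / (‖x - ξ‖ ^ 2 + xN ^ 2) ^ (((n : ℝ) + 2 * γ) / 2) * bubble n γ lam σ ξ

/-- The modified Bessel function of the second kind `K_γ`. -/
def besselK (γ t : ℝ) : ℝ :=
  ∫ s in Set.Ioi (0 : ℝ), Real.exp (-t * Real.cosh s) * Real.cosh (γ * s)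

/-- The function `φ(t) = (2^{1-γ}/Γ(γ)) t^γ K_γ(t)`. -/
def phiK (γ t : ℝ) : ℝ := (2 ^ (1 - γ) / Real.Gamma γ) * t ^ γ * besselK γ t

/-- The constant `d₂`. -/
def dTwo (n : ℕ) (γ : ℝ) : ℝ :=
  2 * Real.Gamma (((n : ℝ) + 2 * γ) / 2) ^ (((n : ℝ) - 2 * γ) / (4 * γ)) /
    Real.Gamma (((n : ℝ) - 2 * γ) / 2) ^ (((n : ℝ) + 2 * γ) / (4 * γ))

/-- The radial profile `ŵ₁(ρ) = d₂ ρ^{-γ} K_γ(ρ)` of the Fourier transform of the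
standard bubble. -/
def whatOne (n : ℕ) (γ ρ : ℝ) : ℝ := dTwo n γ * ρ ^ (-γ) * besselK γ ρ

/-- The constant `A₁ = ∫_0^∞ t^{1-2γ} φ(t)² dt`. -/
def Aone (γ : ℝ) : ℝ := ∫ t in Set.Ioi (0 : ℝ), t ^ (1 - 2 * γ) * (phiK γ t) ^ 2

/-- The constant `B₂ = ∫_0^∞ ρ^{n-3+2γ} ŵ₁(ρ)² dρ`. -/
def Btwo (n : ℕ) (γ : ℝ) : ℝ :=
  ∫ ρ in Set.Ioi (0 : ℝ), ρ ^ ((n : ℝ) - 3 + 2 * γ) * (whatOne n γ ρ) ^ 2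

/-- The total surface measure `|S^{n-1}|` of the unit sphere in `ℝⁿ`. -/
def sphereConst (n : ℕ) : ℝ := 2 * Real.pi ^ ((n : ℝ) / 2) / Real.Gamma ((n : ℝ) / 2)

/-! ### Lebesgue integrals of nonnegative functions -/

theorem lintegral_ofReal_eq_of_integral_eq {α : Type*} [MeasurableSpace α] {μ : Measure α}
    {f : α → ℝ} {c : ℝ} (hc : 0 < c) (hf : 0 ≤ᵐ[μ] f) (h : ∫ x, f x ∂μ = c) :
    ∫⁻ x, ENNReal.ofReal (f x) ∂μ = ENNReal.ofReal c := by
  rw [← h, ofReal_integral_eq_lintegral_ofReal _ hf]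
  by_contra hi
  rw [integral_undef hi] at h
  exact hc.ne h

/-- Tonelli's theorem for a weighted product of two parameter integrals. -/
theorem lintegral_mul_lintegral_mul_lintegral {α β δ : Type*} [MeasurableSpace α]
    [MeasurableSpace β] [MeasurableSpace δ] {μ : Measure α} {ν : Measure β} {ρ : Measure δ}
    [SFinite μ] [SFinite ν] [SFinite ρ] {a : α → ENNReal} {f : α → β → ENNReal}
    {g : α → δ → ENNReal} (ha : Measurable a) (hf : Measurable (Function.uncurry f))
    (hg : Measurable (Function.uncurry g)) :
    ∫⁻ x, a x * (∫⁻ y, f x y ∂ν) * (∫⁻ z, g x z ∂ρ) ∂μ =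
      ∫⁻ y, ∫⁻ z, ∫⁻ x, a x * f x y * g x z ∂μ ∂ρ ∂ν := by
  have h1 : ∀ x, a x * (∫⁻ y, f x y ∂ν) * (∫⁻ z, g x z ∂ρ) =
      ∫⁻ y, ∫⁻ z, a x * f x y * g x z ∂ρ ∂ν := by
    intro x
    have hfx : Measurable (f x) := hf.comp measurable_prodMk_left
    have hgx : Measurable (g x) := hg.comp measurable_prodMk_left
    rw [lintegral_lintegral_mul (hfx.const_mul _).aemeasurable hgx.aemeasurable,
      lintegral_const_mul _ hfx]
  simp_rw [h1]
  rw [lintegral_lintegral_swap]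
  · refine lintegral_congr fun y => ?_
    rw [lintegral_lintegral_swap]
    refine Measurable.aemeasurable ?_
    exact ((ha.comp measurable_fst).mul (hf.comp (measurable_fst.prodMk measurable_const))).mul hg
  · refine Measurable.aemeasurable ?_
    refine Measurable.lintegral_prod_right' (f := fun p : (α × β) × δ =>
      a p.1.1 * f p.1.1 p.1.2 * g p.1.1 p.2) ?_
    exact ((ha.comp measurable_fst.fst).mul (hf.comp measurable_fst)).mul
      (hg.comp (measurable_fst.fst.prodMk measurable_snd))

/-- The integral defining the Gamma function, after scaling. -/
theorem lintegral_rpow_mul_exp {a r : ℝ} (ha : 0 < a) (hr : 0 < r) :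
    ∫⁻ t in Set.Ioi (0 : ℝ), ENNReal.ofReal (t ^ (a - 1) * Real.exp (-(r * t))) =
      ENNReal.ofReal (Real.Gamma a * r ^ (-a)) := by
  have hΓ := Real.Gamma_pos_of_pos ha
  refine lintegral_ofReal_eq_of_integral_eq (by positivity) ?_ ?_
  · filter_upwards [ae_restrict_mem measurableSet_Ioi] with t ht
    have : 0 < t := ht
    simp only [Pi.zero_apply]; positivity
  · rw [Real.integral_rpow_mul_exp_neg_mul_Ioi ha hr, one_div, Real.inv_rpow hr.le,
      Real.rpow_neg hr.le, mul_comm]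

/-- Substitution `t = k s` on the half line. -/
theorem lintegral_comp_mul_Ioi {k : ℝ} (hk : 0 < k) (f : ℝ → ENNReal) :
    ∫⁻ t in Set.Ioi (0 : ℝ), f t = ∫⁻ s in Set.Ioi (0 : ℝ), ENNReal.ofReal k * f (k * s) := by
  have h := lintegral_image_eq_lintegral_abs_deriv_mul (s := Set.Ioi (0 : ℝ))
    (f := fun s => k * s) (f' := fun _ => k) measurableSet_Ioi
    (fun x _ => by simpa using ((hasDerivAt_id x).const_mul k).hasDerivWithinAt)
    (mul_right_injective₀ hk.ne').injOn f
  rw [abs_of_pos hk] at h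
  rw [← h, Set.image_mul_left_Ioi hk, mul_zero]

/-- Substitution `w = k y²` in a Mellin integral on the half line. -/
theorem lintegral_rpow_mul_comp_mul_sq {k : ℝ} (hk : 0 < k) (a : ℝ) (f : ℝ → ENNReal) :
    ∫⁻ y in Set.Ioi (0 : ℝ), ENNReal.ofReal (y ^ (2 * a - 1)) * f (k * y ^ 2) =
      ENNReal.ofReal (k ^ (-a) / 2) *
        ∫⁻ w in Set.Ioi (0 : ℝ), ENNReal.ofReal (w ^ (a - 1)) * f w := by
  have himg : (fun y : ℝ => k * y ^ 2) '' Set.Ioi 0 = Set.Ioi 0 := by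
    ext w
    constructor
    · rintro ⟨y, hy, rfl⟩
      have : 0 < y := hy
      exact Set.mem_Ioi.2 (by positivity)
    · intro hw
      have hw : 0 < w := hw
      refine ⟨√(w / k), Set.mem_Ioi.2 (by positivity), ?_⟩
      simp only
      rw [Real.sq_sqrt (by positivity)]
      field_simp
  have h := lintegral_image_eq_lintegral_abs_deriv_mul (s := Set.Ioi (0 : ℝ))
    (f := fun y => k * y ^ 2) (f' := fun y => k * (2 * y)) measurableSet_Ioi
    (fun x _ => by simpa using (((hasDerivAt_id x).pow 2).const_mul k).hasDerivWithinAt)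
    (by
      intro x hx y hy hxy
      have h2 : x ^ 2 = y ^ 2 := mul_left_cancel₀ hk.ne' hxy
      exact (pow_left_inj₀ (le_of_lt hx) (le_of_lt hy) two_ne_zero).1 h2)
    (fun w => ENNReal.ofReal (w ^ (a - 1)) * f w)
  rw [himg] at h
  rw [h, ← lintegral_const_mul' _ _ ENNReal.ofReal_ne_top]
  refine setLIntegral_congr_fun measurableSet_Ioi fun y hy => ?_
  have hy : 0 < y := hy
  rw [← mul_assoc, ← mul_assoc, ← ENNReal.ofReal_mul (by positivity),
    ← ENNReal.ofReal_mul (by positivity), abs_of_pos (by positivity)]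
  congr 2
  have e1 : (k * y ^ 2) ^ (a - 1) = k ^ a / k * (y ^ (2 * a - 1) / y) := by
    rw [Real.mul_rpow hk.le (by positivity), Real.rpow_sub_one hk.ne', ← Real.rpow_natCast,
      ← Real.rpow_mul hy.le, ← Real.rpow_sub_one hy.ne']
    congr 2
    push_cast; ring
  rw [e1, Real.rpow_neg hk.le]
  have : 0 < k ^ a := by positivity
  field_simp

/-- `∫ |x|² e^{-q|x|²}` over Euclidean space. -/
theorem lintegral_norm_sq_mul_exp (n : ℕ) (hn : 0 < n) {q : ℝ} (hq : 0 < q) :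
    ∫⁻ x : EuclideanSpace ℝ (Fin n), ENNReal.ofReal (‖x‖ ^ 2 * Real.exp (-(q * ‖x‖ ^ 2))) =
      ENNReal.ofReal ((n : ℝ) / 2 * Real.pi ^ ((n : ℝ) / 2) * q ^ (-((n : ℝ) / 2 + 1))) := by
  have hn' : (0 : ℝ) < n := by exact_mod_cast hn
  have : Nonempty (Fin n) := ⟨⟨0, hn⟩⟩
  refine lintegral_ofReal_eq_of_integral_eq (by positivity)
    (Filter.Eventually.of_forall fun x => by simp only [Pi.zero_apply]; positivity) ?_
  rw [integral_fun_norm_addHaar volume (fun r => r ^ 2 * Real.exp (-(q * r ^ 2)))]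
  have hI : ∫ y in Set.Ioi (0 : ℝ), y ^ (n - 1) • (y ^ 2 * Real.exp (-(q * y ^ 2))) =
      Real.Gamma ((n : ℝ) / 2 + 1) / 2 * q ^ (-((n : ℝ) / 2 + 1)) := by
    have h := integral_rpow_mul_exp_neg_mul_rpow (p := 2) (q := n + 1) (b := q) (by norm_num)
      (by linarith) hq
    have e : ((n : ℝ) + 1 + 1) / 2 = n / 2 + 1 := by ring
    rw [neg_div, e] at h
    rw [show Real.Gamma ((n : ℝ) / 2 + 1) / 2 * q ^ (-((n : ℝ) / 2 + 1)) =
      q ^ (-((n : ℝ) / 2 + 1)) * (1 / 2) * Real.Gamma ((n : ℝ) / 2 + 1) by ring, ← h]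
    refine setIntegral_congr_fun measurableSet_Ioi fun y _ => ?_
    simp only [smul_eq_mul, Real.rpow_two, neg_mul]
    rw [← mul_assoc, ← pow_add, show n - 1 + 2 = n + 1 by omega, ← Real.rpow_natCast]
    push_cast; rfl
  have hΓ : 0 < Real.Gamma ((n : ℝ) / 2 + 1) := Real.Gamma_pos_of_pos (by positivity)
  simp only [finrank_euclideanSpace, Fintype.card_fin]
  rw [hI, measureReal_def, EuclideanSpace.volume_ball]
  simp only [ENNReal.ofReal_one, one_pow, one_mul, Fintype.card_fin]
  rw [ENNReal.toReal_ofReal (by positivity), nsmul_eq_mul, smul_eq_mul, Real.sqrt_eq_rpow,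
    ← Real.rpow_mul_natCast Real.pi_pos.le, show 1 / 2 * (n : ℝ) = n / 2 by ring]
  field_simp

/-- The product of two Gaussians integrates to a Gaussian. -/
theorem lintegral_exp_mul_exp (n : ℕ) {t u : ℝ} (ht : 0 < t) (hu : 0 < u)
    (x : EuclideanSpace ℝ (Fin n)) :
    ∫⁻ ξ : EuclideanSpace ℝ (Fin n),
        ENNReal.ofReal (Real.exp (-(t * ‖x - ξ‖ ^ 2 + u * ‖ξ‖ ^ 2))) =
      ENNReal.ofReal ((Real.pi / (t + u)) ^ ((n : ℝ) / 2) *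
        Real.exp (-(t * u / (t + u) * ‖x‖ ^ 2))) := by
  have key : ∀ ξ : EuclideanSpace ℝ (Fin n), Real.exp (-(t * ‖x - ξ‖ ^ 2 + u * ‖ξ‖ ^ 2)) =
      Real.exp (-(t + u) * ‖ξ - (t / (t + u)) • x‖ ^ 2) *
        Real.exp (-(t * u / (t + u) * ‖x‖ ^ 2)) := by
    intro ξ
    rw [← Real.exp_add, norm_sub_sq_real, norm_sub_sq_real, inner_smul_right, norm_smul,
      real_inner_comm, mul_pow, Real.norm_eq_abs, sq_abs]
    congr 1
    field_simp
    ring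
  simp_rw [key]
  refine lintegral_ofReal_eq_of_integral_eq (by positivity)
    (Filter.Eventually.of_forall fun ξ => by simp only [Pi.zero_apply]; positivity) ?_
  rw [integral_mul_const, integral_sub_right_eq_self (fun ξ : EuclideanSpace ℝ (Fin n) =>
    Real.exp (-(t + u) * ‖ξ‖ ^ 2)), GaussianFourier.integral_rexp_neg_mul_sq_norm (by positivity),
    finrank_euclideanSpace, Fintype.card_fin]

/-! ### Bessel functions through Gaussian subordination -/

/-- The integral `∫_0^∞ s^{ν-1} e^{-s-w/s} ds`, which equals `2 w^{ν/2} K_ν(2 √w)`. -/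
def besselProfile (ν w : ℝ) : ENNReal :=
  ∫⁻ s in Set.Ioi (0 : ℝ), ENNReal.ofReal (s ^ (ν - 1) * Real.exp (-s - w / s))

theorem measurable_besselProfile (ν : ℝ) : Measurable (besselProfile ν) := by
  refine Measurable.lintegral_prod_right' (f := fun p : ℝ × ℝ =>
    ENNReal.ofReal (p.2 ^ (ν - 1) * Real.exp (-p.2 - p.1 / p.2))) ?_
  fun_prop

theorem lintegral_lintegral_dirichlet {a b p : ℝ} (hp : 0 < a + b - p) :
    ∫⁻ s in Set.Ioi (0 : ℝ), ∫⁻ r in Set.Ioi (0 : ℝ),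
        ENNReal.ofReal (s ^ (a - 1) * r ^ (b - 1) * (s + r) ^ (-p) * Real.exp (-(s + r))) =
      ENNReal.ofReal (Real.Gamma (a + b - p)) *
        ∫⁻ v in Set.Ioi (0 : ℝ), ENNReal.ofReal (v ^ (b - 1) * (1 + v) ^ (-(a + b))) := by
  have h1 : ∀ s ∈ Set.Ioi (0 : ℝ), (∫⁻ r in Set.Ioi (0 : ℝ),
      ENNReal.ofReal (s ^ (a - 1) * r ^ (b - 1) * (s + r) ^ (-p) * Real.exp (-(s + r)))) =
      ∫⁻ v in Set.Ioi (0 : ℝ), ENNReal.ofReal (v ^ (b - 1) * (1 + v) ^ (-p) *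
        (s ^ (a + b - p - 1) * Real.exp (-((1 + v) * s)))) := by
    intro s hs
    have hs : 0 < s := hs
    rw [lintegral_comp_mul_Ioi hs]
    refine setLIntegral_congr_fun measurableSet_Ioi fun v hv => ?_
    have hv : 0 < v := hv
    rw [← ENNReal.ofReal_mul hs.le]
    congr 1
    rw [show s + s * v = s * (1 + v) by ring, Real.mul_rpow hs.le hv.le,
      Real.mul_rpow hs.le (by positivity),
      show a + b - p - 1 = 1 + (a - 1) + (b - 1) + -p by ring, Real.rpow_add hs,
      Real.rpow_add hs, Real.rpow_add hs, Real.rpow_one, mul_comm s (1 + v)]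
    ring
  rw [setLIntegral_congr_fun measurableSet_Ioi h1, lintegral_lintegral_swap (by
    refine Measurable.aemeasurable ?_
    unfold Function.uncurry
    fun_prop), ← lintegral_const_mul' _ _ ENNReal.ofReal_ne_top]
  refine setLIntegral_congr_fun measurableSet_Ioi fun v hv => ?_
  have hv : 0 < v := hv
  have hv1 : 0 < 1 + v := by linarith
  have h2 : ∀ s : ℝ, ENNReal.ofReal (v ^ (b - 1) * (1 + v) ^ (-p) *
        (s ^ (a + b - p - 1) * Real.exp (-((1 + v) * s)))) =
      ENNReal.ofReal (v ^ (b - 1) * (1 + v) ^ (-p)) *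
        ENNReal.ofReal (s ^ (a + b - p - 1) * Real.exp (-((1 + v) * s))) :=
    fun s => ENNReal.ofReal_mul (by positivity)
  simp_rw [h2]
  rw [lintegral_const_mul' _ _ ENNReal.ofReal_ne_top, lintegral_rpow_mul_exp hp hv1,
    ← ENNReal.ofReal_mul (by positivity),
    ← ENNReal.ofReal_mul (Real.Gamma_pos_of_pos hp).le]
  congr 1
  rw [show -(a + b) = -p + -(a + b - p) by ring, Real.rpow_add hv1]
  ring

theorem lintegral_beta {a b : ℝ} (ha : 0 < a) (hb : 0 < b) :
    ∫⁻ v in Set.Ioi (0 : ℝ), ENNReal.ofReal (v ^ (b - 1) * (1 + v) ^ (-(a + b))) =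
      ENNReal.ofReal (Real.Gamma a * Real.Gamma b / Real.Gamma (a + b)) := by
  have hΓ : 0 < Real.Gamma (a + b) := Real.Gamma_pos_of_pos (by positivity)
  have hΓa : 0 < Real.Gamma a := Real.Gamma_pos_of_pos ha
  have h := lintegral_lintegral_dirichlet (a := a) (b := b) (p := 0) (by linarith)
  have ga := lintegral_rpow_mul_exp ha one_pos
  have gb := lintegral_rpow_mul_exp hb one_pos
  simp only [one_mul, Real.one_rpow, mul_one] at ga gb
  have e : ∀ s ∈ Set.Ioi (0 : ℝ), (∫⁻ r in Set.Ioi (0 : ℝ), ENNReal.ofReal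
        (s ^ (a - 1) * r ^ (b - 1) * (s + r) ^ (-0 : ℝ) * Real.exp (-(s + r)))) =
      ∫⁻ r in Set.Ioi (0 : ℝ), ENNReal.ofReal (s ^ (a - 1) * Real.exp (-s)) *
        ENNReal.ofReal (r ^ (b - 1) * Real.exp (-r)) := by
    intro s hs
    have hs : 0 < s := hs
    refine lintegral_congr fun r => ?_
    rw [← ENNReal.ofReal_mul (by positivity), neg_zero, Real.rpow_zero, neg_add, Real.exp_add]
    congr 1; ring
  rw [setLIntegral_congr_fun measurableSet_Ioi e, lintegral_lintegral_mul
    (Measurable.aemeasurable (by fun_prop)) (Measurable.aemeasurable (by fun_prop)), ga, gb,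
    sub_zero, ← ENNReal.ofReal_mul hΓa.le] at h
  rw [ENNReal.ofReal_div_of_pos hΓ]
  exact (ENNReal.eq_div_iff (by simpa using hΓ) ENNReal.ofReal_ne_top).2 h.symm

/-- The Mellin transform at `p` of the product of the Bessel profiles of orders `μ` and `ν`. -/
def besselMoment (p μ ν : ℝ) : ℝ :=
  Real.Gamma p * Real.Gamma (p + μ + ν) * Real.Gamma (p + μ) * Real.Gamma (p + ν) /
    Real.Gamma (2 * p + μ + ν)

theorem besselMoment_pos {p μ ν : ℝ} (hp : 0 < p) (hμ : 0 < p + μ) (hν : 0 < p + ν)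
    (hμν : 0 < p + μ + ν) : 0 < besselMoment p μ ν := by
  have h1 := Real.Gamma_pos_of_pos hp
  have h2 := Real.Gamma_pos_of_pos hμ
  have h3 := Real.Gamma_pos_of_pos hν
  have h4 := Real.Gamma_pos_of_pos hμν
  have h5 : 0 < Real.Gamma (2 * p + μ + ν) := Real.Gamma_pos_of_pos (by linarith)
  unfold besselMoment; positivity

/-- The Mellin transform of a product of two Bessel profiles. -/
theorem lintegral_besselProfile_mul {p μ ν : ℝ} (hp : 0 < p) (hμ : 0 < p + μ) (hν : 0 < p + ν)
    (hμν : 0 < p + μ + ν) :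
    ∫⁻ w in Set.Ioi (0 : ℝ), ENNReal.ofReal (w ^ (p - 1)) * besselProfile μ w *
        besselProfile ν w =
      ENNReal.ofReal (besselMoment p μ ν) := by
  unfold besselProfile
  have hΓ := Real.Gamma_pos_of_pos hp
  rw [lintegral_mul_lintegral_mul_lintegral (by fun_prop)
    (by unfold Function.uncurry; fun_prop) (by unfold Function.uncurry; fun_prop)]
  have h1 : ∀ s ∈ Set.Ioi (0 : ℝ), (∫⁻ r in Set.Ioi (0 : ℝ), ∫⁻ w in Set.Ioi (0 : ℝ),
        ENNReal.ofReal (w ^ (p - 1)) * ENNReal.ofReal (s ^ (μ - 1) * Real.exp (-s - w / s)) *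
          ENNReal.ofReal (r ^ (ν - 1) * Real.exp (-r - w / r))) =
      ENNReal.ofReal (Real.Gamma p) * ∫⁻ r in Set.Ioi (0 : ℝ), ENNReal.ofReal
        (s ^ (p + μ - 1) * r ^ (p + ν - 1) * (s + r) ^ (-p) * Real.exp (-(s + r))) := by
    intro s hs
    have hs : 0 < s := hs
    rw [← lintegral_const_mul' _ _ ENNReal.ofReal_ne_top]
    refine setLIntegral_congr_fun measurableSet_Ioi fun r hr => ?_
    have hr : 0 < r := hr
    have h2 : ∀ w ∈ Set.Ioi (0 : ℝ), ENNReal.ofReal (w ^ (p - 1)) *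
          ENNReal.ofReal (s ^ (μ - 1) * Real.exp (-s - w / s)) *
          ENNReal.ofReal (r ^ (ν - 1) * Real.exp (-r - w / r)) =
        ENNReal.ofReal (s ^ (μ - 1) * r ^ (ν - 1) * Real.exp (-(s + r))) *
          ENNReal.ofReal (w ^ (p - 1) * Real.exp (-((1 / s + 1 / r) * w))) := by
      intro w hw
      have hw : 0 < w := hw
      rw [← ENNReal.ofReal_mul (by positivity), ← ENNReal.ofReal_mul (by positivity),
        ← ENNReal.ofReal_mul (by positivity)]
      congr 1
      rw [show -((1 / s + 1 / r) * w) = -(w / s) + -(w / r) by ring, neg_add, sub_eq_add_neg (-s),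
        sub_eq_add_neg (-r), Real.exp_add, Real.exp_add, Real.exp_add, Real.exp_add]
      ring
    rw [setLIntegral_congr_fun measurableSet_Ioi h2,
      lintegral_const_mul' _ _ ENNReal.ofReal_ne_top, lintegral_rpow_mul_exp hp (by positivity),
      ← ENNReal.ofReal_mul (by positivity), ← ENNReal.ofReal_mul hΓ.le]
    congr 1
    rw [show 1 / s + 1 / r = (s + r) / (s * r) by field_simp; ring, Real.rpow_neg (by positivity),
      Real.div_rpow (by positivity) (by positivity), Real.mul_rpow hs.le hr.le,
      show p + μ - 1 = p + (μ - 1) by ring, show p + ν - 1 = p + (ν - 1) by ring,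
      Real.rpow_add hs, Real.rpow_add hr, Real.rpow_neg (by positivity)]
    have : 0 < s ^ p := by positivity
    have : 0 < r ^ p := by positivity
    have : 0 < (s + r) ^ p := by positivity
    field_simp
  rw [setLIntegral_congr_fun measurableSet_Ioi h1,
    lintegral_const_mul' _ _ ENNReal.ofReal_ne_top,
    lintegral_lintegral_dirichlet (by linarith), lintegral_beta hμ hν,
    ← ENNReal.ofReal_mul (Real.Gamma_pos_of_pos (by linarith)).le, ← ENNReal.ofReal_mul hΓ.le,
    show p + μ + (p + ν) - p = p + μ + ν by ring, show p + μ + (p + ν) = 2 * p + μ + ν by ring]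
  congr 1
  rw [besselMoment]
  ring

/-- Substitution `t = e^s`. -/
theorem lintegral_comp_exp (f : ℝ → ENNReal) :
    ∫⁻ t in Set.Ioi (0 : ℝ), f t = ∫⁻ s : ℝ, ENNReal.ofReal (Real.exp s) * f (Real.exp s) := by
  have h := lintegral_image_eq_lintegral_abs_deriv_mul (s := Set.univ) MeasurableSet.univ
    (fun x _ => (Real.hasDerivAt_exp x).hasDerivWithinAt) Real.exp_injective.injOn f
  simpa only [Set.image_univ, Real.range_exp, Measure.restrict_univ, abs_of_pos (Real.exp_pos _)]
    using h

theorem lintegral_eq_lintegral_Ioi_add_neg {f : ℝ → ENNReal} (hf : Measurable f) :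
    ∫⁻ s, f s = ∫⁻ s in Set.Ioi (0 : ℝ), (f s + f (-s)) := by
  have h := lintegral_image_eq_lintegral_abs_deriv_mul (s := Set.Ioi (0 : ℝ)) measurableSet_Ioi
    (fun x _ => (hasDerivAt_neg x).hasDerivWithinAt) neg_injective.injOn f
  simp only [Set.image_neg_eq_neg, Set.neg_Ioi, neg_zero, abs_neg, abs_one, ENNReal.ofReal_one,
    one_mul] at h
  rw [lintegral_add_left hf, ← h, ← lintegral_add_compl f (measurableSet_Ioi (a := (0 : ℝ))),
    Set.compl_Ioi, restrict_Iio_eq_restrict_Iic]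

theorem besselProfile_eq_lintegral_cosh (ν : ℝ) {t : ℝ} (ht : 0 < t) :
    besselProfile ν (1 / 4 * t ^ 2) = ENNReal.ofReal (2 * (t / 2) ^ ν) *
      ∫⁻ s in Set.Ioi (0 : ℝ),
        ENNReal.ofReal (Real.exp (-t * Real.cosh s) * Real.cosh (ν * s)) := by
  have ht2 : 0 < t / 2 := by positivity
  unfold besselProfile
  rw [lintegral_comp_mul_Ioi ht2, lintegral_comp_exp, lintegral_eq_lintegral_Ioi_add_neg
    (by fun_prop), ← lintegral_const_mul' _ _ ENNReal.ofReal_ne_top]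
  refine lintegral_congr fun s => ?_
  have key : ∀ r : ℝ, ENNReal.ofReal (Real.exp r) * (ENNReal.ofReal (t / 2) *
      ENNReal.ofReal ((t / 2 * Real.exp r) ^ (ν - 1) *
        Real.exp (-(t / 2 * Real.exp r) - 1 / 4 * t ^ 2 / (t / 2 * Real.exp r)))) =
      ENNReal.ofReal ((t / 2) ^ ν * (Real.exp (-t * Real.cosh r) * Real.exp (ν * r))) := by
    intro r
    rw [← ENNReal.ofReal_mul (by positivity), ← ENNReal.ofReal_mul (by positivity)]
    congr 1
    have e1 : -(t / 2 * Real.exp r) - 1 / 4 * t ^ 2 / (t / 2 * Real.exp r) =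
        -t * Real.cosh r := by
      rw [Real.cosh_eq, Real.exp_neg]
      field_simp
      ring
    rw [e1, Real.mul_rpow ht2.le (Real.exp_pos r).le, ← Real.exp_mul, Real.rpow_sub_one ht2.ne',
      show ν * r = r + r * (ν - 1) by ring, Real.exp_add]
    field_simp
  rw [key, key, Real.cosh_neg, ← ENNReal.ofReal_add (by positivity) (by positivity),
    ← ENNReal.ofReal_mul (by positivity), Real.cosh_eq (ν * s), mul_neg]
  congr 1; ring

theorem besselK_eq_toReal (ν t : ℝ) : besselK ν t = (∫⁻ s in Set.Ioi (0 : ℝ),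
    ENNReal.ofReal (Real.exp (-t * Real.cosh s) * Real.cosh (ν * s))).toReal := by
  unfold besselK
  refine integral_eq_lintegral_of_nonneg_ae (Filter.Eventually.of_forall fun s => ?_)
    (Measurable.aestronglyMeasurable (by fun_prop))
  have := Real.cosh_pos (ν * s)
  simp only [Pi.zero_apply]; positivity

theorem besselK_nonneg (ν t : ℝ) : 0 ≤ besselK ν t := by
  rw [besselK_eq_toReal]; exact ENNReal.toReal_nonneg

theorem measurable_besselK (ν : ℝ) : Measurable (besselK ν) := by
  rw [funext (besselK_eq_toReal ν)]
  refine Measurable.ennreal_toReal ?_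
  refine Measurable.lintegral_prod_right' (f := fun p : ℝ × ℝ =>
    ENNReal.ofReal (Real.exp (-p.1 * Real.cosh p.2) * Real.cosh (ν * p.2))) ?_
  fun_prop

theorem besselProfile_lt_top {ν w : ℝ} (hν : 0 < ν) (hw : 0 < w) : besselProfile ν w < ⊤ := by
  refine lt_of_le_of_lt ?_ (ENNReal.ofReal_lt_top (r := Real.Gamma ν * 1 ^ (-ν)))
  rw [← lintegral_rpow_mul_exp hν one_pos, besselProfile]
  refine setLIntegral_mono' measurableSet_Ioi fun s hs => ENNReal.ofReal_le_ofReal ?_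
  have hs : 0 < s := hs
  refine mul_le_mul_of_nonneg_left (Real.exp_le_exp.2 ?_) (by positivity)
  have : 0 < w / s := by positivity
  linarith

theorem ofReal_besselK {ν t : ℝ} (hν : 0 < ν) (ht : 0 < t) :
    ENNReal.ofReal (besselK ν t) = ∫⁻ s in Set.Ioi (0 : ℝ),
      ENNReal.ofReal (Real.exp (-t * Real.cosh s) * Real.cosh (ν * s)) := by
  rw [besselK_eq_toReal]
  refine ENNReal.ofReal_toReal fun h => ?_
  have h2 := besselProfile_lt_top hν (w := 1 / 4 * t ^ 2) (by positivity)
  have : 0 < 2 * (t / 2) ^ ν := by positivity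
  rw [besselProfile_eq_lintegral_cosh ν ht, h, ENNReal.mul_top (by simpa using this)] at h2
  exact h2.ne rfl

theorem besselProfile_eq_besselK {ν t : ℝ} (hν : 0 < ν) (ht : 0 < t) :
    besselProfile ν (1 / 4 * t ^ 2) = ENNReal.ofReal (2 * (t / 2) ^ ν * besselK ν t) := by
  rw [besselProfile_eq_lintegral_cosh ν ht, ← ofReal_besselK hν ht,
    ← ENNReal.ofReal_mul (by positivity)]

theorem besselProfile_neg_eq_besselK {ν t : ℝ} (hν : 0 < ν) (ht : 0 < t) :
    besselProfile (-ν) (1 / 4 * t ^ 2) = ENNReal.ofReal (2 * (t / 2) ^ (-ν) * besselK ν t) := by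
  rw [ENNReal.ofReal_mul (by positivity), ofReal_besselK hν ht,
    besselProfile_eq_lintegral_cosh (-ν) ht]
  simp only [neg_mul, Real.cosh_neg]

/-- Moments of the square of a multiple of a Bessel profile. -/
theorem integral_rpow_mul_sq_of_besselProfile {a c ν : ℝ} {g : ℝ → ℝ} (hc : 0 ≤ c)
    (hg : Measurable g) (hg0 : ∀ t, 0 < t → 0 ≤ g t)
    (hgE : ∀ t, 0 < t → ENNReal.ofReal (g t) =
      ENNReal.ofReal c * besselProfile ν (1 / 4 * t ^ 2))
    (ha : 0 < a) (haν : 0 < a + ν) (haν2 : 0 < a + ν + ν) :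
    ∫ t in Set.Ioi (0 : ℝ), t ^ (2 * a - 1) * g t ^ 2 =
      c ^ 2 * (2 ^ (2 * a) / 2) * besselMoment a ν ν := by
  have hM := besselMoment_pos ha haν haν haν2
  rw [integral_eq_lintegral_of_nonneg_ae]
  · have e : ∀ t ∈ Set.Ioi (0 : ℝ), ENNReal.ofReal (t ^ (2 * a - 1) * g t ^ 2) =
        ENNReal.ofReal (c ^ 2) * (ENNReal.ofReal (t ^ (2 * a - 1)) *
          (fun w => besselProfile ν w * besselProfile ν w) (1 / 4 * t ^ 2)) := by
      intro t ht
      have ht : 0 < t := ht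
      rw [ENNReal.ofReal_mul (by positivity), ENNReal.ofReal_pow (hg0 t ht), hgE t ht,
        ENNReal.ofReal_pow hc]
      ring
    rw [setLIntegral_congr_fun measurableSet_Ioi e,
      lintegral_const_mul' _ _ ENNReal.ofReal_ne_top,
      lintegral_rpow_mul_comp_mul_sq (k := 1 / 4) (by norm_num) a
        (fun w => besselProfile ν w * besselProfile ν w)]
    simp_rw [← mul_assoc (ENNReal.ofReal _) (besselProfile ν _)]
    rw [lintegral_besselProfile_mul ha haν haν haν2, ← ENNReal.ofReal_mul (by positivity),
      ← ENNReal.ofReal_mul (by positivity), ENNReal.toReal_ofReal (by positivity),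
      show (1 / 4 : ℝ) ^ (-a) = 2 ^ (2 * a) by
        rw [Real.rpow_mul (by norm_num), one_div, Real.inv_rpow (by norm_num),
          Real.rpow_neg (by norm_num), inv_inv]
        norm_num]
    ring
  · filter_upwards [ae_restrict_mem measurableSet_Ioi] with t ht
    have : 0 < t := ht
    simp only [Pi.zero_apply]; positivity
  · exact Measurable.aestronglyMeasurable (by fun_prop)

theorem Aone_eq {γ : ℝ} (hγ0 : 0 < γ) (hγ1 : γ < 1) :
    Aone γ = 2 ^ (1 - 2 * γ) / Real.Gamma γ ^ 2 *
      besselMoment (1 - γ) γ γ := by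
  have hΓ := Real.Gamma_pos_of_pos hγ0
  have hm := measurable_besselK γ
  have h := integral_rpow_mul_sq_of_besselProfile (a := 1 - γ) (c := 1 / Real.Gamma γ) (ν := γ)
    (g := phiK γ) (by positivity) (by unfold phiK; fun_prop)
    (fun t ht => by
      have := besselK_nonneg γ t
      unfold phiK; positivity)
    (fun t ht => by
      rw [besselProfile_eq_besselK hγ0 ht, ← ENNReal.ofReal_mul (by positivity)]
      congr 1
      rw [phiK, Real.div_rpow ht.le (by norm_num), Real.rpow_sub (by norm_num), Real.rpow_one]
      field_simp)
    (by linarith) (by linarith) (by linarith)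
  rw [show 2 * (1 - γ) - 1 = 1 - 2 * γ by ring,
    show 2 * (1 - γ) = 1 - 2 * γ + 1 by ring, Real.rpow_add_one (by norm_num)] at h
  rw [Aone, h]
  ring

theorem dTwo_pos {n : ℕ} {γ : ℝ} (hγ : 0 < γ) (hn : 2 * γ < n) : 0 < dTwo n γ := by
  have h1 : 0 < Real.Gamma (((n : ℝ) + 2 * γ) / 2) := Real.Gamma_pos_of_pos (by linarith)
  have h2 : 0 < Real.Gamma (((n : ℝ) - 2 * γ) / 2) := Real.Gamma_pos_of_pos (by linarith)
  unfold dTwo; positivity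

theorem Btwo_eq {n : ℕ} {γ : ℝ} (hγ0 : 0 < γ) (hn : 2 * γ + 2 < n) :
    Btwo n γ = dTwo n γ ^ 2 * 2 ^ ((n : ℝ) - 5) *
      besselMoment ((n : ℝ) / 2 - 1 + γ) (-γ) (-γ) := by
  have hd := dTwo_pos hγ0 (show 2 * γ < n by linarith)
  have hm := measurable_besselK γ
  have h := integral_rpow_mul_sq_of_besselProfile (a := (n : ℝ) / 2 - 1 + γ)
    (c := dTwo n γ * 2 ^ (-γ) / 2) (ν := -γ)
    (g := whatOne n γ) (by positivity) (by unfold whatOne; fun_prop)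
    (fun t ht => by
      have := besselK_nonneg γ t
      unfold whatOne; positivity)
    (fun t ht => by
      rw [besselProfile_neg_eq_besselK hγ0 ht, ← ENNReal.ofReal_mul (by positivity)]
      congr 1
      rw [whatOne, Real.div_rpow ht.le (by norm_num)]
      have : (0 : ℝ) < 2 ^ (-γ) := by positivity
      field_simp)
    (by linarith) (by linarith) (by linarith)
  rw [show 2 * ((n : ℝ) / 2 - 1 + γ) - 1 = n - 3 + 2 * γ by ring] at h
  have e : (2 : ℝ) ^ (2 * ((n : ℝ) / 2 - 1 + γ)) * (2 ^ (-γ)) ^ 2 = 2 ^ ((n : ℝ) - 5) * 8 := by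
    rw [← Real.rpow_mul_natCast (by norm_num), ← Real.rpow_add (by norm_num),
      show (8 : ℝ) = 2 ^ (3 : ℝ) by norm_num, ← Real.rpow_add (by norm_num)]
    congr 1; push_cast; ring
  rw [Btwo, h]
  linear_combination (dTwo n γ ^ 2 / 8 * besselMoment ((n : ℝ) / 2 - 1 + γ) (-γ) (-γ)) * e

/-! ### Weighted square integrals of Gaussian mixtures -/

/-- The second moment of the square of a superposition of heat kernels, on the Fourier side. -/
theorem lintegral_norm_sq_mul_gaussian_mixture_sq {n : ℕ} (hn : 0 < n) {P : Type*}
    [MeasurableSpace P] {μ : Measure P} [SFinite μ] {h : P → ENNReal} (hh : Measurable h)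
    {T : P → ℝ} (hT : Measurable T) (hT0 : ∀ᵐ p ∂μ, 0 < T p) :
    ∫⁻ x : EuclideanSpace ℝ (Fin n), ENNReal.ofReal (‖x‖ ^ 2) *
        (∫⁻ p, h p * ENNReal.ofReal (T p ^ (-((n : ℝ) / 2)) * Real.exp (-(‖x‖ ^ 2 / T p))) ∂μ) ^ 2 =
      ENNReal.ofReal (sphereConst n / 2) * ∫⁻ k in Set.Ioi (0 : ℝ),
        ENNReal.ofReal (k ^ ((n : ℝ) / 2)) *
        (∫⁻ p, h p * ENNReal.ofReal (T p * Real.exp (-(k * T p))) ∂μ) ^ 2 := by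
  have hn' : (0 : ℝ) < n := by exact_mod_cast hn
  have hΓ : 0 < Real.Gamma ((n : ℝ) / 2) := Real.Gamma_pos_of_pos (by positivity)
  have hS : 0 < sphereConst n := by unfold sphereConst; positivity
  simp_rw [sq (lintegral _ _), ← mul_assoc]
  rw [lintegral_mul_lintegral_mul_lintegral (by fun_prop)
      (by unfold Function.uncurry; fun_prop) (by unfold Function.uncurry; fun_prop),
    lintegral_mul_lintegral_mul_lintegral (by fun_prop)
      (by unfold Function.uncurry; fun_prop) (by unfold Function.uncurry; fun_prop),
    ← lintegral_const_mul' _ _ ENNReal.ofReal_ne_top]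
  refine lintegral_congr_ae ?_
  filter_upwards [hT0] with p hp
  rw [← lintegral_const_mul' _ _ ENNReal.ofReal_ne_top]
  refine lintegral_congr_ae ?_
  filter_upwards [hT0] with p' hp'
  have hx : ∀ x : EuclideanSpace ℝ (Fin n), ENNReal.ofReal (‖x‖ ^ 2) *
      (h p * ENNReal.ofReal (T p ^ (-((n : ℝ) / 2)) * Real.exp (-(‖x‖ ^ 2 / T p)))) *
      (h p' * ENNReal.ofReal (T p' ^ (-((n : ℝ) / 2)) * Real.exp (-(‖x‖ ^ 2 / T p')))) =
      h p * h p' * ENNReal.ofReal (T p ^ (-((n : ℝ) / 2)) * T p' ^ (-((n : ℝ) / 2))) *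
        ENNReal.ofReal (‖x‖ ^ 2 * Real.exp (-((1 / T p + 1 / T p') * ‖x‖ ^ 2))) := by
    intro x
    rw [show -((1 / T p + 1 / T p') * ‖x‖ ^ 2) = -(‖x‖ ^ 2 / T p) + -(‖x‖ ^ 2 / T p') by ring,
      Real.exp_add, ENNReal.ofReal_mul (by positivity), ENNReal.ofReal_mul (by positivity),
      ENNReal.ofReal_mul (by positivity), ENNReal.ofReal_mul (by positivity),
      ENNReal.ofReal_mul (by positivity)]
    ring
  have hk : ∀ k ∈ Set.Ioi (0 : ℝ), ENNReal.ofReal (k ^ ((n : ℝ) / 2)) *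
      (h p * ENNReal.ofReal (T p * Real.exp (-(k * T p)))) *
      (h p' * ENNReal.ofReal (T p' * Real.exp (-(k * T p')))) =
      h p * h p' * ENNReal.ofReal (T p * T p') *
        ENNReal.ofReal (k ^ ((n : ℝ) / 2 + 1 - 1) * Real.exp (-((T p + T p') * k))) := by
    intro k hk
    have hk : 0 < k := hk
    rw [show -((T p + T p') * k) = -(k * T p) + -(k * T p') by ring, add_sub_cancel_right,
      Real.exp_add, ENNReal.ofReal_mul (by positivity), ENNReal.ofReal_mul (by positivity),
      ENNReal.ofReal_mul (by positivity), ENNReal.ofReal_mul (by positivity),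
      ENNReal.ofReal_mul (by positivity)]
    ring
  simp_rw [hx]
  rw [setLIntegral_congr_fun measurableSet_Ioi hk, lintegral_const_mul _ (by fun_prop),
    lintegral_const_mul _ (by fun_prop), lintegral_norm_sq_mul_exp n hn (by positivity),
    lintegral_rpow_mul_exp (by positivity) (by positivity)]
  rw [mul_assoc (h p * h p'), ← ENNReal.ofReal_mul (by positivity), mul_assoc (h p * h p'),
    ← ENNReal.ofReal_mul (by positivity), mul_left_comm (ENNReal.ofReal (sphereConst n / 2)),
    ← ENNReal.ofReal_mul (by positivity)]
  congr 2
  rw [show 1 / T p + 1 / T p' = (T p + T p') / (T p * T p') by field_simp; ring,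
    Real.div_rpow (by positivity) (by positivity), Real.mul_rpow hp.le hp'.le, sphereConst,
    Real.Gamma_add_one (by positivity), neg_add, Real.rpow_add hp, Real.rpow_add hp',
    Real.rpow_neg_one, Real.rpow_neg_one]
  have := Real.rpow_pos_of_pos hp (-((n : ℝ) / 2))
  have := Real.rpow_pos_of_pos hp' (-((n : ℝ) / 2))
  field_simp

/-- The Poisson integral of the bubble as a superposition of Gaussians. -/
theorem lintegral_poisson_bubble {n : ℕ} {γ : ℝ} (hγ : 0 < γ) (hn : 2 * γ < n) {y : ℝ}
    (hy : 0 < y) (x : EuclideanSpace ℝ (Fin n)) :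
    ∫⁻ ξ : EuclideanSpace ℝ (Fin n), ENNReal.ofReal
        (y ^ (2 * γ) / (‖x - ξ‖ ^ 2 + y ^ 2) ^ (((n : ℝ) + 2 * γ) / 2) * bubble n γ 1 0 ξ) =
      ENNReal.ofReal (cng n γ * Real.pi ^ ((n : ℝ) / 2) /
        (Real.Gamma (((n : ℝ) + 2 * γ) / 2) * Real.Gamma (((n : ℝ) - 2 * γ) / 2)) * y ^ (2 * γ)) *
      ∫⁻ p, ENNReal.ofReal (p.1 ^ (γ - 1) * p.2 ^ (-γ - 1) * Real.exp (-(p.1 * y ^ 2) - p.2)) *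
        ENNReal.ofReal ((1 / p.1 + 1 / p.2) ^ (-((n : ℝ) / 2)) *
          Real.exp (-(‖x‖ ^ 2 / (1 / p.1 + 1 / p.2))))
        ∂((volume.restrict (Set.Ioi (0 : ℝ))).prod (volume.restrict (Set.Ioi (0 : ℝ)))) := by
  set α := ((n : ℝ) + 2 * γ) / 2 with hα
  set β := ((n : ℝ) - 2 * γ) / 2 with hβ
  have hα0 : 0 < α := by rw [hα]; linarith
  have hβ0 : 0 < β := by rw [hβ]; linarith
  have hΓα := Real.Gamma_pos_of_pos hα0
  have hΓβ := Real.Gamma_pos_of_pos hβ0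
  have hc : 0 < cng n γ := by unfold cng; rw [← hα, ← hβ]; positivity
  have e1 : ∀ ξ : EuclideanSpace ℝ (Fin n), ENNReal.ofReal
      (y ^ (2 * γ) / (‖x - ξ‖ ^ 2 + y ^ 2) ^ α * bubble n γ 1 0 ξ) =
      ENNReal.ofReal (cng n γ * y ^ (2 * γ) / (Real.Gamma α * Real.Gamma β)) *
        (∫⁻ t in Set.Ioi (0 : ℝ),
          ENNReal.ofReal (t ^ (α - 1) * Real.exp (-((‖x - ξ‖ ^ 2 + y ^ 2) * t)))) *
        (∫⁻ u in Set.Ioi (0 : ℝ),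
          ENNReal.ofReal (u ^ (β - 1) * Real.exp (-((1 + ‖ξ‖ ^ 2) * u)))) := by
    intro ξ
    rw [lintegral_rpow_mul_exp hα0 (by positivity), lintegral_rpow_mul_exp hβ0 (by positivity),
      ← ENNReal.ofReal_mul (by positivity), ← ENNReal.ofReal_mul (by positivity), bubble, ← hβ,
      Real.rpow_neg (by positivity), Real.rpow_neg (by positivity), sub_zero, one_pow, one_div,
      Real.inv_rpow (by positivity)]
    congr 1
    field_simp
  simp_rw [e1]
  rw [lintegral_mul_lintegral_mul_lintegral (by fun_prop)
      (by unfold Function.uncurry; fun_prop) (by unfold Function.uncurry; fun_prop),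
    lintegral_prod _ (Measurable.aemeasurable (by fun_prop)),
    ← lintegral_const_mul' _ _ ENNReal.ofReal_ne_top]
  refine setLIntegral_congr_fun measurableSet_Ioi fun t ht => ?_
  simp only
  rw [← lintegral_const_mul' _ _ ENNReal.ofReal_ne_top]
  refine setLIntegral_congr_fun measurableSet_Ioi fun u hu => ?_
  have ht : 0 < t := ht
  have hu : 0 < u := hu
  have e2 : ∀ ξ : EuclideanSpace ℝ (Fin n),
      ENNReal.ofReal (cng n γ * y ^ (2 * γ) / (Real.Gamma α * Real.Gamma β)) *
        ENNReal.ofReal (t ^ (α - 1) * Real.exp (-((‖x - ξ‖ ^ 2 + y ^ 2) * t))) *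
        ENNReal.ofReal (u ^ (β - 1) * Real.exp (-((1 + ‖ξ‖ ^ 2) * u))) =
      ENNReal.ofReal (cng n γ * y ^ (2 * γ) / (Real.Gamma α * Real.Gamma β) * t ^ (α - 1) *
          u ^ (β - 1) * Real.exp (-(t * y ^ 2) - u)) *
        ENNReal.ofReal (Real.exp (-(t * ‖x - ξ‖ ^ 2 + u * ‖ξ‖ ^ 2))) := by
    intro ξ
    rw [← ENNReal.ofReal_mul (by positivity), ← ENNReal.ofReal_mul (by positivity),
      ← ENNReal.ofReal_mul (by positivity), mul_assoc _ (Real.exp _) (Real.exp _),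
      ← Real.exp_add, show -(t * y ^ 2) - u + -(t * ‖x - ξ‖ ^ 2 + u * ‖ξ‖ ^ 2) =
        -((‖x - ξ‖ ^ 2 + y ^ 2) * t) + -((1 + ‖ξ‖ ^ 2) * u) by ring, Real.exp_add]
    congr 1; ring
  simp_rw [e2]
  rw [lintegral_const_mul' _ _ ENNReal.ofReal_ne_top, lintegral_exp_mul_exp n ht hu,
    ← ENNReal.ofReal_mul (by positivity), ← ENNReal.ofReal_mul (by positivity),
    ← ENNReal.ofReal_mul (by positivity)]
  congr 1
  rw [show ‖x‖ ^ 2 / (1 / t + 1 / u) = t * u / (t + u) * ‖x‖ ^ 2 by field_simp; ring,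
    show 1 / t + 1 / u = (t + u) / (t * u) by field_simp; ring,
    Real.div_rpow Real.pi_pos.le (by positivity), Real.div_rpow (by positivity) (by positivity),
    Real.mul_rpow ht.le hu.le, show α - 1 = n / 2 + (γ - 1) by rw [hα]; ring,
    show β - 1 = n / 2 + (-γ - 1) by rw [hβ]; ring, Real.rpow_add ht, Real.rpow_add hu,
    Real.rpow_neg ht.le, Real.rpow_neg hu.le, Real.rpow_neg (by positivity)]
  field_simp

theorem lintegral_rpow_mul_exp_eq_besselProfile (ν k : ℝ) {y : ℝ} (hy : 0 < y) :
    ∫⁻ t in Set.Ioi (0 : ℝ), ENNReal.ofReal (t ^ (ν - 1) * Real.exp (-(t * y ^ 2) - k / t)) =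
      ENNReal.ofReal (y ^ (-(2 * ν))) * besselProfile ν (k * y ^ 2) := by
  rw [besselProfile, lintegral_comp_mul_Ioi (pow_pos hy 2)
      (fun s => ENNReal.ofReal (s ^ (ν - 1) * Real.exp (-s - k * y ^ 2 / s))),
    ← lintegral_const_mul' _ _ ENNReal.ofReal_ne_top]
  refine setLIntegral_congr_fun measurableSet_Ioi fun t ht => ?_
  have ht : 0 < t := ht
  rw [← ENNReal.ofReal_mul (by positivity), ← ENNReal.ofReal_mul (by positivity)]
  congr 1
  rw [Real.mul_rpow (by positivity) ht.le, Real.rpow_sub_one (pow_pos hy 2).ne',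
    show (y ^ 2) ^ ν = y ^ (2 * ν) by rw [Real.rpow_mul hy.le, Real.rpow_two], Real.rpow_neg hy.le,
    show k * y ^ 2 / (y ^ 2 * t) = k / t by field_simp, mul_comm (y ^ 2) t]
  have : 0 < y ^ (2 * ν) := by positivity
  field_simp

/-- The radial derivative of the Fourier transform of the extended bubble, in terms of Bessel
profiles. -/
theorem lintegral_mixture_eq_besselProfile (γ k : ℝ) {y : ℝ} (hy : 0 < y) :
    ∫⁻ p, ENNReal.ofReal (p.1 ^ (γ - 1) * p.2 ^ (-γ - 1) * Real.exp (-(p.1 * y ^ 2) - p.2)) *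
        ENNReal.ofReal ((1 / p.1 + 1 / p.2) * Real.exp (-(k * (1 / p.1 + 1 / p.2))))
        ∂((volume.restrict (Set.Ioi (0 : ℝ))).prod (volume.restrict (Set.Ioi (0 : ℝ)))) =
      ENNReal.ofReal (y ^ (-(2 * γ))) * (ENNReal.ofReal (y ^ 2) *
        besselProfile (γ - 1) (k * y ^ 2) * besselProfile (-γ) k +
          besselProfile γ (k * y ^ 2) * besselProfile (-γ - 1) k) := by
  rw [lintegral_prod _ (Measurable.aemeasurable (by fun_prop))]
  have e : ∀ t ∈ Set.Ioi (0 : ℝ), (∫⁻ u in Set.Ioi (0 : ℝ),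
      ENNReal.ofReal (t ^ (γ - 1) * u ^ (-γ - 1) * Real.exp (-(t * y ^ 2) - u)) *
        ENNReal.ofReal ((1 / t + 1 / u) * Real.exp (-(k * (1 / t + 1 / u))))) =
      ENNReal.ofReal (t ^ (γ - 1 - 1) * Real.exp (-(t * y ^ 2) - k / t)) * besselProfile (-γ) k +
        ENNReal.ofReal (t ^ (γ - 1) * Real.exp (-(t * y ^ 2) - k / t)) *
          besselProfile (-γ - 1) k := by
    intro t ht
    have ht : 0 < t := ht
    rw [besselProfile, besselProfile, ← lintegral_const_mul' _ _ ENNReal.ofReal_ne_top,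
      ← lintegral_const_mul' _ _ ENNReal.ofReal_ne_top, ← lintegral_add_left (by fun_prop)]
    refine setLIntegral_congr_fun measurableSet_Ioi fun u hu => ?_
    have hu : 0 < u := hu
    rw [← ENNReal.ofReal_mul (by positivity), ← ENNReal.ofReal_mul (by positivity),
      ← ENNReal.ofReal_mul (by positivity),
      ← ENNReal.ofReal_add (by positivity) (by positivity)]
    congr 1
    rw [Real.rpow_sub_one ht.ne' (γ - 1), Real.rpow_sub_one hu.ne' (-γ - 1),
      show -(k * (1 / t + 1 / u)) = -(k / t) + -(k / u) by ring,
      sub_eq_add_neg _ (k / t), sub_eq_add_neg _ (k / u), sub_eq_add_neg _ u, Real.exp_add,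
      Real.exp_add, Real.exp_add, Real.exp_add]
    field_simp
  rw [setLIntegral_congr_fun measurableSet_Ioi e, lintegral_add_left (by fun_prop),
    lintegral_mul_const _ (by fun_prop), lintegral_mul_const _ (by fun_prop),
    lintegral_rpow_mul_exp_eq_besselProfile _ _ hy, lintegral_rpow_mul_exp_eq_besselProfile _ _ hy,
    show -(2 * (γ - 1)) = -(2 * γ) + (2 : ℕ) by push_cast; ring, Real.rpow_add hy,
    Real.rpow_natCast, ENNReal.ofReal_mul (by positivity)]
  ring

/-- Separation of variables through the substitution `w = k y²`. -/
theorem lintegral_lintegral_comp_mul_sq (a m : ℝ) {Φ Ψ : ℝ → ENNReal} (hΦ : Measurable Φ)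
    (hΨ : Measurable Ψ) :
    ∫⁻ y in Set.Ioi (0 : ℝ), ∫⁻ k in Set.Ioi (0 : ℝ),
        ENNReal.ofReal (y ^ (2 * a - 1)) * ENNReal.ofReal (k ^ (m + a)) * Φ (k * y ^ 2) * Ψ k =
      ENNReal.ofReal (1 / 2) * (∫⁻ w in Set.Ioi (0 : ℝ), ENNReal.ofReal (w ^ (a - 1)) * Φ w) *
        ∫⁻ k in Set.Ioi (0 : ℝ), ENNReal.ofReal (k ^ m) * Ψ k := by
  rw [lintegral_lintegral_swap (by
    refine Measurable.aemeasurable ?_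
    unfold Function.uncurry
    fun_prop), ← lintegral_const_mul _ (by fun_prop)]
  refine setLIntegral_congr_fun measurableSet_Ioi fun k hk => ?_
  have hk : 0 < k := hk
  have e : ∀ y : ℝ, ENNReal.ofReal (y ^ (2 * a - 1)) * ENNReal.ofReal (k ^ (m + a)) *
      Φ (k * y ^ 2) * Ψ k = ENNReal.ofReal (k ^ (m + a)) * Ψ k *
        (ENNReal.ofReal (y ^ (2 * a - 1)) * Φ (k * y ^ 2)) := fun y => by ring
  simp_rw [e]
  rw [lintegral_const_mul _ (by fun_prop), lintegral_rpow_mul_comp_mul_sq hk a Φ]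
  have e2 : ENNReal.ofReal (k ^ (m + a)) * ENNReal.ofReal (k ^ (-a) / 2) =
      ENNReal.ofReal (1 / 2) * ENNReal.ofReal (k ^ m) := by
    rw [← ENNReal.ofReal_mul (by positivity), ← ENNReal.ofReal_mul (by positivity)]
    congr 1
    rw [Real.rpow_add hk, Real.rpow_neg hk.le]
    have : 0 < k ^ a := by positivity
    field_simp
  rw [← mul_assoc, mul_right_comm _ (Ψ k), e2]
  ring

theorem lintegral_lintegral_besselProfile_mul {a q μ ν μ' ν' : ℝ} (ha : 0 < a)
    (hμ : 0 < a + μ) (hν : 0 < a + ν) (hμν : 0 < a + μ + ν) (hq : 0 < q) (hμ' : 0 < q + μ')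
    (hν' : 0 < q + ν') (hμν' : 0 < q + μ' + ν') :
    ∫⁻ y in Set.Ioi (0 : ℝ), ∫⁻ k in Set.Ioi (0 : ℝ),
        ENNReal.ofReal (y ^ (2 * a - 1)) * ENNReal.ofReal (k ^ (q - 1 + a)) *
          (besselProfile μ (k * y ^ 2) * besselProfile ν (k * y ^ 2)) *
          (besselProfile μ' k * besselProfile ν' k) =
      ENNReal.ofReal (1 / 2 * besselMoment a μ ν * besselMoment q μ' ν') := by
  have hE := measurable_besselProfile
  have h := lintegral_lintegral_comp_mul_sq a (q - 1)
    (Φ := fun w => besselProfile μ w * besselProfile ν w)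
    (Ψ := fun w => besselProfile μ' w * besselProfile ν' w) (by fun_prop) (by fun_prop)
  refine h.trans ?_
  simp_rw [← mul_assoc (ENNReal.ofReal _) (besselProfile _ _)]
  rw [lintegral_besselProfile_mul ha hμ hν hμν, lintegral_besselProfile_mul hq hμ' hν' hμν',
    ← ENNReal.ofReal_mul (by positivity), ← ENNReal.ofReal_mul
      (mul_nonneg (by positivity) (besselMoment_pos ha hμ hν hμν).le)]

theorem besselMoment_three_sub {γ : ℝ} (hγ1 : γ < 1) :
    besselMoment (3 - γ) (γ - 1) (γ - 1) =
      (2 - γ) * (1 - γ) / 6 * besselMoment (1 - γ) γ γ := by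
  have g1 := Real.Gamma_add_one (s := 1 - γ) (by linarith)
  have g2 := Real.Gamma_add_one (s := 1 - γ + 1) (by linarith)
  have h4 : Real.Gamma 4 = 6 := by
    rw [show (4 : ℝ) = (3 : ℕ) + 1 by norm_num, Real.Gamma_nat_eq_factorial]
    norm_num [Nat.factorial]
  rw [besselMoment, besselMoment, show 3 - γ = 1 - γ + 1 + 1 by ring,
    show 1 - γ + 1 + 1 + (γ - 1) + (γ - 1) = 1 + γ by ring,
    show 1 - γ + 1 + 1 + (γ - 1) = 2 by ring,
    show 2 * (1 - γ + 1 + 1) + (γ - 1) + (γ - 1) = 4 by ring,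
    show 1 - γ + γ + γ = 1 + γ by ring, show 1 - γ + γ = 1 by ring,
    show 2 * (1 - γ) + γ + γ = 2 by ring, g2, g1, h4, Real.Gamma_two, Real.Gamma_one]
  ring

theorem besselMoment_two_sub {γ : ℝ} (hγ1 : γ < 1) :
    besselMoment (2 - γ) (γ - 1) γ = (1 - γ) / 2 * besselMoment (1 - γ) γ γ := by
  have g1 := Real.Gamma_add_one (s := 1 - γ) (by linarith)
  have h3 : Real.Gamma 3 = 2 := by
    rw [show (3 : ℝ) = (2 : ℕ) + 1 by norm_num, Real.Gamma_nat_eq_factorial]; norm_num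
  rw [besselMoment, besselMoment, show 2 - γ = 1 - γ + 1 by ring,
    show 1 - γ + 1 + (γ - 1) + γ = 1 + γ by ring,
    show 1 - γ + 1 + (γ - 1) = 1 by ring, show 1 - γ + 1 + γ = 2 by ring,
    show 2 * (1 - γ + 1) + (γ - 1) + γ = 3 by ring,
    show 1 - γ + γ + γ = 1 + γ by ring, show 1 - γ + γ = 1 by ring,
    show 2 * (1 - γ) + γ + γ = 2 by ring, g1, h3, Real.Gamma_two, Real.Gamma_one]
  ring

/-- Raising the argument of a moment of the squared profile of order `-γ` by one. -/
theorem besselMoment_add_one_neg {q γ : ℝ} (hγ0 : 0 < γ) (hq : 2 * γ < q) :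
    besselMoment (q + 1) (-γ) (-γ) =
      q * (q - 2 * γ) * (q - γ) ^ 2 / ((2 * q - 2 * γ) * (2 * q - 2 * γ + 1)) *
        besselMoment q (-γ) (-γ) := by
  have g1 := Real.Gamma_add_one (s := q) (by linarith)
  have g2 := Real.Gamma_add_one (s := q - 2 * γ) (by linarith)
  have g3 := Real.Gamma_add_one (s := q - γ) (by linarith)
  have g4 := Real.Gamma_add_one (s := 2 * q - 2 * γ) (by linarith)
  have g5 := Real.Gamma_add_one (s := 2 * q - 2 * γ + 1) (by linarith)
  have h0 : Real.Gamma (2 * q - 2 * γ) ≠ 0 := (Real.Gamma_pos_of_pos (by linarith)).ne'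
  have h1 : 2 * q - 2 * γ ≠ 0 := by linarith
  have h2 : 2 * q - 2 * γ + 1 ≠ 0 := by linarith
  rw [besselMoment, besselMoment, show q + 1 + -γ + -γ = q - 2 * γ + 1 by ring,
    show q + 1 + -γ = q - γ + 1 by ring,
    show 2 * (q + 1) + -γ + -γ = 2 * q - 2 * γ + 1 + 1 by ring,
    show q + -γ + -γ = q - 2 * γ by ring, show q + -γ = q - γ by ring,
    show 2 * q + -γ + -γ = 2 * q - 2 * γ by ring, g1, g2, g3, g5, g4]
  field_simp

theorem besselMoment_add_one_neg_neg_sub_one {q γ : ℝ} (hγ0 : 0 < γ) (hq : 2 * γ < q) :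
    besselMoment (q + 1) (-γ) (-γ - 1) =
      q * (q - γ) / (2 * q - 2 * γ) * besselMoment q (-γ) (-γ) := by
  have g1 := Real.Gamma_add_one (s := q) (by linarith)
  have g3 := Real.Gamma_add_one (s := q - γ) (by linarith)
  have g4 := Real.Gamma_add_one (s := 2 * q - 2 * γ) (by linarith)
  have h0 : Real.Gamma (2 * q - 2 * γ) ≠ 0 := (Real.Gamma_pos_of_pos (by linarith)).ne'
  have h1 : 2 * q - 2 * γ ≠ 0 := by linarith
  rw [besselMoment, besselMoment, show q + 1 + -γ + (-γ - 1) = q - 2 * γ by ring,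
    show q + 1 + -γ = q - γ + 1 by ring, show q + 1 + (-γ - 1) = q - γ by ring,
    show 2 * (q + 1) + -γ + (-γ - 1) = 2 * q - 2 * γ + 1 by ring,
    show q + -γ + -γ = q - 2 * γ by ring, show q + -γ = q - γ by ring,
    show 2 * q + -γ + -γ = 2 * q - 2 * γ by ring, g1, g3, g4]
  field_simp

theorem besselMoment_add_two_neg_sub_one {q γ : ℝ} (hγ0 : 0 < γ) (hq : 2 * γ < q) :
    besselMoment (q + 2) (-γ - 1) (-γ - 1) =
      q * (q + 1) * (q - γ) ^ 2 / ((2 * q - 2 * γ) * (2 * q - 2 * γ + 1)) *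
        besselMoment q (-γ) (-γ) := by
  have g1 := Real.Gamma_add_one (s := q) (by linarith)
  have g2 := Real.Gamma_add_one (s := q + 1) (by linarith)
  have g3 := Real.Gamma_add_one (s := q - γ) (by linarith)
  have g4 := Real.Gamma_add_one (s := 2 * q - 2 * γ) (by linarith)
  have g5 := Real.Gamma_add_one (s := 2 * q - 2 * γ + 1) (by linarith)
  have h0 : Real.Gamma (2 * q - 2 * γ) ≠ 0 := (Real.Gamma_pos_of_pos (by linarith)).ne'
  have h1 : 2 * q - 2 * γ ≠ 0 := by linarith
  have h2 : 2 * q - 2 * γ + 1 ≠ 0 := by linarith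
  rw [besselMoment, besselMoment, show q + 2 + (-γ - 1) + (-γ - 1) = q - 2 * γ by ring,
    show q + 2 + (-γ - 1) = q - γ + 1 by ring,
    show 2 * (q + 2) + (-γ - 1) + (-γ - 1) = 2 * q - 2 * γ + 1 + 1 by ring,
    show q + 2 = q + 1 + 1 by ring,
    show q + -γ + -γ = q - 2 * γ by ring, show q + -γ = q - γ by ring,
    show 2 * q + -γ + -γ = 2 * q - 2 * γ by ring, g2, g1, g3, g5, g4]
  field_simp

theorem lintegral_lintegral_besselProfile_sq {m γ : ℝ} (hγ0 : 0 < γ) (hγ1 : γ < 1)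
    (hm : γ + 2 < m) :
    ∫⁻ y in Set.Ioi (0 : ℝ), ∫⁻ k in Set.Ioi (0 : ℝ),
        ENNReal.ofReal (y ^ (1 - 2 * γ)) * ENNReal.ofReal (k ^ m) *
          (ENNReal.ofReal (y ^ 2) * besselProfile (γ - 1) (k * y ^ 2) * besselProfile (-γ) k +
            besselProfile γ (k * y ^ 2) * besselProfile (-γ - 1) k) ^ 2 =
      ENNReal.ofReal (m * (3 * m ^ 2 - 9 * m + 7 - γ ^ 2) /
        (6 * (m - 2) * (m - 2 - γ) * (m - 2 + γ)) * besselMoment (1 - γ) γ γ *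
        besselMoment (m - 1 + γ) (-γ) (-γ)) := by
  have hE := measurable_besselProfile
  have hexp : ∀ y ∈ Set.Ioi (0 : ℝ), (∫⁻ k in Set.Ioi (0 : ℝ),
      ENNReal.ofReal (y ^ (1 - 2 * γ)) * ENNReal.ofReal (k ^ m) *
        (ENNReal.ofReal (y ^ 2) * besselProfile (γ - 1) (k * y ^ 2) * besselProfile (-γ) k +
          besselProfile γ (k * y ^ 2) * besselProfile (-γ - 1) k) ^ 2) =
      (∫⁻ k in Set.Ioi (0 : ℝ), ENNReal.ofReal (y ^ (2 * (3 - γ) - 1)) *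
        ENNReal.ofReal (k ^ (m + γ - 2 - 1 + (3 - γ))) *
        (besselProfile (γ - 1) (k * y ^ 2) * besselProfile (γ - 1) (k * y ^ 2)) *
        (besselProfile (-γ) k * besselProfile (-γ) k)) +
      2 * (∫⁻ k in Set.Ioi (0 : ℝ), ENNReal.ofReal (y ^ (2 * (2 - γ) - 1)) *
        ENNReal.ofReal (k ^ (m + γ - 1 - 1 + (2 - γ))) *
        (besselProfile (γ - 1) (k * y ^ 2) * besselProfile γ (k * y ^ 2)) *
        (besselProfile (-γ) k * besselProfile (-γ - 1) k)) +
      ∫⁻ k in Set.Ioi (0 : ℝ), ENNReal.ofReal (y ^ (2 * (1 - γ) - 1)) *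
        ENNReal.ofReal (k ^ (m + γ - 1 + (1 - γ))) *
        (besselProfile γ (k * y ^ 2) * besselProfile γ (k * y ^ 2)) *
        (besselProfile (-γ - 1) k * besselProfile (-γ - 1) k) := by
    intro y hy
    have hy : 0 < y := hy
    rw [← lintegral_const_mul _ (by fun_prop), ← lintegral_add_left (by fun_prop),
      ← lintegral_add_left (by fun_prop)]
    refine lintegral_congr fun k => ?_
    rw [show 2 * (3 - γ) - 1 = 1 - 2 * γ + (2 : ℕ) + (2 : ℕ) by push_cast; ring,
      show 2 * (2 - γ) - 1 = 1 - 2 * γ + (2 : ℕ) by push_cast; ring,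
      show 2 * (1 - γ) - 1 = 1 - 2 * γ by ring, show m + γ - 2 - 1 + (3 - γ) = m by ring,
      show m + γ - 1 - 1 + (2 - γ) = m by ring, show m + γ - 1 + (1 - γ) = m by ring,
      Real.rpow_add hy, Real.rpow_add hy, Real.rpow_natCast, ENNReal.ofReal_mul (by positivity),
      ENNReal.ofReal_mul (by positivity)]
    ring
  rw [setLIntegral_congr_fun measurableSet_Ioi hexp, lintegral_add_left (by fun_prop),
    lintegral_add_left (by fun_prop), lintegral_const_mul _ (by fun_prop),
    lintegral_lintegral_besselProfile_mul (by linarith) (by linarith) (by linarith) (by linarith)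
      (by linarith) (by linarith) (by linarith) (by linarith),
    lintegral_lintegral_besselProfile_mul (by linarith) (by linarith) (by linarith) (by linarith)
      (by linarith) (by linarith) (by linarith) (by linarith),
    lintegral_lintegral_besselProfile_mul (by linarith) (by linarith) (by linarith) (by linarith)
      (by linarith) (by linarith) (by linarith) (by linarith),
    ← ENNReal.ofReal_ofNat, ← ENNReal.ofReal_mul (by norm_num), ← ENNReal.ofReal_add ?_ ?_,
    ← ENNReal.ofReal_add ?_ ?_]
  · congr 1
    set q := m + γ - 2 with hq
    have hm' : m = q - γ + 2 := by rw [hq]; ring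
    have h1 : q - γ ≠ 0 := by linarith
    have h2 : q - 2 * γ ≠ 0 := by linarith
    have h3 : q ≠ 0 := by linarith
    have h4 : 2 * q - 2 * γ = 2 * (q - γ) := by ring
    have h5 : 2 * (q - γ) + 1 ≠ 0 := by linarith
    rw [show m + γ - 1 = q + 1 by rw [hq]; ring, show m + γ = q + 2 by rw [hq]; ring,
      show m - 1 + γ = q + 1 by rw [hq]; ring, besselMoment_three_sub hγ1,
      besselMoment_two_sub hγ1, besselMoment_add_one_neg hγ0 (by linarith),
      besselMoment_add_one_neg_neg_sub_one hγ0 (by linarith),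
      besselMoment_add_two_neg_sub_one hγ0 (by linarith), show m - 2 = q - γ by rw [hq]; ring,
      show q - γ - γ = q - 2 * γ by ring, show q - γ + γ = q by ring, h4, hm']
    field_simp
    ring
  all_goals
    have M1 := besselMoment_pos (p := 3 - γ) (μ := γ - 1) (ν := γ - 1) (by linarith) (by linarith)
      (by linarith) (by linarith)
    have M2 := besselMoment_pos (p := 2 - γ) (μ := γ - 1) (ν := γ) (by linarith) (by linarith)
      (by linarith) (by linarith)
    have M3 := besselMoment_pos (p := 1 - γ) (μ := γ) (ν := γ) (by linarith) (by linarith)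
      (by linarith) (by linarith)
    have N1 := besselMoment_pos (p := m + γ - 2) (μ := -γ) (ν := -γ) (by linarith) (by linarith)
      (by linarith) (by linarith)
    have N2 := besselMoment_pos (p := m + γ - 1) (μ := -γ) (ν := -γ - 1) (by linarith)
      (by linarith) (by linarith) (by linarith)
    have N3 := besselMoment_pos (p := m + γ) (μ := -γ - 1) (ν := -γ - 1) (by linarith)
      (by linarith) (by linarith) (by linarith)
    positivity

/-! ### The extended bubble -/

/-- The Poisson integral of the standard bubble at `(x, y)`, without its normalizing constant. -/
def poissonBubble (n : ℕ) (γ y : ℝ) (x : EuclideanSpace ℝ (Fin n)) : ENNReal :=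
  ∫⁻ ξ : EuclideanSpace ℝ (Fin n), ENNReal.ofReal
    (y ^ (2 * γ) / (‖x - ξ‖ ^ 2 + y ^ 2) ^ (((n : ℝ) + 2 * γ) / 2) * bubble n γ 1 0 ξ)

theorem measurable_bubble (n : ℕ) (γ lam : ℝ) (σ : EuclideanSpace ℝ (Fin n)) :
    Measurable (bubble n γ lam σ) := by
  unfold bubble; fun_prop

theorem measurable_poissonBubble (n : ℕ) (γ : ℝ) :
    Measurable (Function.uncurry (poissonBubble n γ)) := by
  have hb := measurable_bubble n γ 1 0
  refine Measurable.lintegral_prod_right' (f := fun p : (ℝ × EuclideanSpace ℝ (Fin n)) ×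
    EuclideanSpace ℝ (Fin n) => ENNReal.ofReal (p.1.1 ^ (2 * γ) /
      (‖p.1.2 - p.2‖ ^ 2 + p.1.1 ^ 2) ^ (((n : ℝ) + 2 * γ) / 2) * bubble n γ 1 0 p.2)) ?_
  fun_prop

theorem measurable_bubbleExt (n : ℕ) (γ : ℝ) :
    Measurable fun p : ℝ × EuclideanSpace ℝ (Fin n) => bubbleExt n γ 1 0 p.2 p.1 := by
  have hb := measurable_bubble n γ 1 0
  refine Measurable.const_mul (StronglyMeasurable.measurable
    (StronglyMeasurable.integral_prod_right' (f := fun p : (ℝ × EuclideanSpace ℝ (Fin n)) ×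
      EuclideanSpace ℝ (Fin n) => p.1.1 ^ (2 * γ) /
        (‖p.1.2 - p.2‖ ^ 2 + p.1.1 ^ 2) ^ (((n : ℝ) + 2 * γ) / 2) * bubble n γ 1 0 p.2) ?_)) _
  exact Measurable.stronglyMeasurable (by fun_prop)

theorem cng_pos {n : ℕ} {γ : ℝ} (hγ : 0 < γ) (hn : 2 * γ < n) : 0 < cng n γ := by
  have h1 : 0 < Real.Gamma (((n : ℝ) + 2 * γ) / 2) := Real.Gamma_pos_of_pos (by linarith)
  have h2 : 0 < Real.Gamma (((n : ℝ) - 2 * γ) / 2) := Real.Gamma_pos_of_pos (by linarith)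
  unfold cng; positivity

theorem bubbleExt_eq_toReal {n : ℕ} {γ : ℝ} (hγ : 0 < γ) (hn : 2 * γ < n) {y : ℝ} (hy : 0 < y)
    (x : EuclideanSpace ℝ (Fin n)) :
    bubbleExt n γ 1 0 x y = png n γ * (poissonBubble n γ y x).toReal := by
  have hb := measurable_bubble n γ 1 0
  have hc := cng_pos hγ hn
  rw [bubbleExt, integral_eq_lintegral_of_nonneg_ae, poissonBubble]
  · refine Filter.Eventually.of_forall fun ξ => ?_
    simp only [Pi.zero_apply, bubble]
    positivity
  · exact Measurable.aestronglyMeasurable (by fun_prop)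

theorem lintegral_norm_sq_mul_poissonBubble_sq {n : ℕ} {γ : ℝ} (hγ : 0 < γ) (hn : 2 * γ < n)
    {y : ℝ} (hy : 0 < y) :
    ∫⁻ x : EuclideanSpace ℝ (Fin n), ENNReal.ofReal (‖x‖ ^ 2) * poissonBubble n γ y x ^ 2 =
      ENNReal.ofReal ((cng n γ * Real.pi ^ ((n : ℝ) / 2) /
        (Real.Gamma (((n : ℝ) + 2 * γ) / 2) * Real.Gamma (((n : ℝ) - 2 * γ) / 2))) ^ 2 *
          (sphereConst n / 2)) *
      ∫⁻ k in Set.Ioi (0 : ℝ), ENNReal.ofReal (k ^ ((n : ℝ) / 2)) *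
        (ENNReal.ofReal (y ^ 2) * besselProfile (γ - 1) (k * y ^ 2) * besselProfile (-γ) k +
          besselProfile γ (k * y ^ 2) * besselProfile (-γ - 1) k) ^ 2 := by
  have hc := cng_pos hγ hn
  have h1 : 0 < Real.Gamma (((n : ℝ) + 2 * γ) / 2) := Real.Gamma_pos_of_pos (by linarith)
  have h2 : 0 < Real.Gamma (((n : ℝ) - 2 * γ) / 2) := Real.Gamma_pos_of_pos (by linarith)
  set C := cng n γ * Real.pi ^ ((n : ℝ) / 2) /
    (Real.Gamma (((n : ℝ) + 2 * γ) / 2) * Real.Gamma (((n : ℝ) - 2 * γ) / 2)) with hC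
  have hC0 : 0 < C := by positivity
  have hn0 : 0 < n := by
    have : (0 : ℝ) < n := by linarith
    exact_mod_cast this
  have hT : ∀ᵐ p : ℝ × ℝ ∂((volume.restrict (Set.Ioi (0 : ℝ))).prod
      (volume.restrict (Set.Ioi (0 : ℝ)))), 0 < 1 / p.1 + 1 / p.2 := by
    rw [Measure.prod_restrict]
    filter_upwards [ae_restrict_mem (measurableSet_Ioi.prod measurableSet_Ioi)] with p hp
    have h1 : 0 < p.1 := hp.1
    have h2 : 0 < p.2 := hp.2
    positivity
  have hV : ∀ x : EuclideanSpace ℝ (Fin n),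
      ENNReal.ofReal (‖x‖ ^ 2) * poissonBubble n γ y x ^ 2 =
      ENNReal.ofReal (C * y ^ (2 * γ)) ^ 2 * (ENNReal.ofReal (‖x‖ ^ 2) * (∫⁻ p,
        ENNReal.ofReal (p.1 ^ (γ - 1) * p.2 ^ (-γ - 1) * Real.exp (-(p.1 * y ^ 2) - p.2)) *
          ENNReal.ofReal ((1 / p.1 + 1 / p.2) ^ (-((n : ℝ) / 2)) *
            Real.exp (-(‖x‖ ^ 2 / (1 / p.1 + 1 / p.2))))
        ∂((volume.restrict (Set.Ioi (0 : ℝ))).prod (volume.restrict (Set.Ioi (0 : ℝ))))) ^ 2) := by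
    intro x
    rw [poissonBubble, lintegral_poisson_bubble hγ hn hy x]
    ring
  have hy2 : ENNReal.ofReal (C * y ^ (2 * γ)) ^ 2 * ENNReal.ofReal (y ^ (-(2 * γ))) ^ 2 =
      ENNReal.ofReal (C ^ 2) := by
    rw [← mul_pow, ← ENNReal.ofReal_mul (by positivity), mul_assoc, ← Real.rpow_add hy,
      add_neg_cancel, Real.rpow_zero, mul_one, ENNReal.ofReal_pow hC0.le]
  simp_rw [hV]
  rw [lintegral_const_mul' _ _ (by finiteness), lintegral_norm_sq_mul_gaussian_mixture_sq hn0
    (by fun_prop) (T := fun p : ℝ × ℝ => 1 / p.1 + 1 / p.2) (by fun_prop) hT]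
  simp_rw [lintegral_mixture_eq_besselProfile γ _ hy, mul_pow (ENNReal.ofReal (y ^ (-(2 * γ)))),
    mul_left_comm (ENNReal.ofReal (_ ^ ((n : ℝ) / 2)))]
  rw [lintegral_const_mul' _ _ (by finiteness), ENNReal.ofReal_mul (sq_nonneg C), ← hy2]
  ring

theorem lintegral_lintegral_poissonBubble_sq {n : ℕ} {γ : ℝ} (hγ0 : 0 < γ) (hγ1 : γ < 1)
    (hn : 2 * γ + 4 < n) :
    ∫⁻ y in Set.Ioi (0 : ℝ), ∫⁻ x : EuclideanSpace ℝ (Fin n),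
        ENNReal.ofReal (y ^ (1 - 2 * γ)) * (ENNReal.ofReal (‖x‖ ^ 2) *
          poissonBubble n γ y x ^ 2) =
      ENNReal.ofReal ((cng n γ * Real.pi ^ ((n : ℝ) / 2) /
        (Real.Gamma (((n : ℝ) + 2 * γ) / 2) * Real.Gamma (((n : ℝ) - 2 * γ) / 2))) ^ 2 *
          (sphereConst n / 2) * ((n : ℝ) / 2 * (3 * ((n : ℝ) / 2) ^ 2 - 9 * ((n : ℝ) / 2) + 7 -
            γ ^ 2) / (6 * ((n : ℝ) / 2 - 2) * ((n : ℝ) / 2 - 2 - γ) * ((n : ℝ) / 2 - 2 + γ)) *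
        besselMoment (1 - γ) γ γ * besselMoment ((n : ℝ) / 2 - 1 + γ) (-γ) (-γ))) := by
  have hS : 0 ≤ sphereConst n := by
    have : 0 < Real.Gamma ((n : ℝ) / 2) := Real.Gamma_pos_of_pos (by linarith)
    unfold sphereConst; positivity
  have hE := measurable_besselProfile
  rw [ENNReal.ofReal_mul (by positivity),
    ← lintegral_lintegral_besselProfile_sq hγ0 hγ1 (show γ + 2 < (n : ℝ) / 2 by linarith),
    ← lintegral_const_mul _ (by fun_prop)]
  refine setLIntegral_congr_fun measurableSet_Ioi fun y hy => ?_
  rw [lintegral_const_mul' _ _ ENNReal.ofReal_ne_top,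
    lintegral_norm_sq_mul_poissonBubble_sq hγ0 (by linarith) hy]
  simp_rw [mul_assoc (ENNReal.ofReal (y ^ (1 - 2 * γ)))]
  rw [lintegral_const_mul' _ _ ENNReal.ofReal_ne_top]
  ring

theorem integral_integral_eq_of_lintegral_lintegral_eq {α β : Type*} [MeasurableSpace α]
    [MeasurableSpace β] {μ : Measure α} {ν : Measure β} [SFinite ν] {f : α → β → ℝ}
    (hf : Measurable (Function.uncurry f)) (hf0 : ∀ᵐ a ∂μ, ∀ b, 0 ≤ f a b) {c : ℝ} (hc : 0 ≤ c)
    (h : ∫⁻ a, ∫⁻ b, ENNReal.ofReal (f a b) ∂ν ∂μ = ENNReal.ofReal c) :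
    ∫ a, ∫ b, f a b ∂ν ∂μ = c := by
  have hm : Measurable fun a => ∫⁻ b, ENNReal.ofReal (f a b) ∂ν :=
    Measurable.lintegral_prod_right' (f := fun p : α × β => ENNReal.ofReal (f p.1 p.2))
      (ENNReal.measurable_ofReal.comp hf)
  have e : ∀ᵐ a ∂μ, ∫ b, f a b ∂ν = (∫⁻ b, ENNReal.ofReal (f a b) ∂ν).toReal := by
    filter_upwards [hf0] with a ha
    exact integral_eq_lintegral_of_nonneg_ae (Filter.Eventually.of_forall ha)
      (hf.of_uncurry_left).aestronglyMeasurable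
  rw [integral_congr_ae e, integral_toReal hm.aemeasurable
    (ae_lt_top hm (by rw [h]; exact ENNReal.ofReal_ne_top)), h, ENNReal.toReal_ofReal hc]

theorem dTwo_eq {n : ℕ} {γ : ℝ} (hγ : 0 < γ) (hn : 2 * γ < n) :
    dTwo n γ = cng n γ * 2 ^ (1 - ((n : ℝ) - 2 * γ) / 2) /
      Real.Gamma (((n : ℝ) - 2 * γ) / 2) := by
  have h1 : 0 < Real.Gamma (((n : ℝ) + 2 * γ) / 2) := Real.Gamma_pos_of_pos (by linarith)
  have h2 : 0 < Real.Gamma (((n : ℝ) - 2 * γ) / 2) := Real.Gamma_pos_of_pos (by linarith)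
  rw [dTwo, cng, Real.div_rpow h1.le h2.le, Real.rpow_sub (by norm_num), Real.rpow_one,
    show ((n : ℝ) + 2 * γ) / (4 * γ) = ((n : ℝ) - 2 * γ) / (4 * γ) + 1 by field_simp; ring,
    Real.rpow_add_one h2.ne']
  field_simp

theorem stmt_17 (n : ℕ) (γ : ℝ) (hγ0 : 0 < γ) (hγ1 : γ < 1) (hn : 2 * γ + 8 < (n : ℝ)) :
    (∫ xN in Set.Ioi (0 : ℝ), ∫ x : EuclideanSpace ℝ (Fin n),
        xN ^ (1 - 2 * γ) * ‖x‖ ^ 2 * (bubbleExt n γ 1 0 x xN) ^ 2) =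
      sphereConst n *
        ((n : ℝ) * (3 * ((n : ℝ) - 3) ^ 2 + (1 - 4 * γ ^ 2)) /
          (3 * ((n : ℝ) - 4) * ((n : ℝ) - 2 * γ - 4) * ((n : ℝ) + 2 * γ - 4))) *
        (Aone γ * Btwo n γ) := by
  have hn0 : n ≠ 0 := by
    rintro rfl
    norm_num at hn
    linarith
  have : Nonempty (Fin n) := ⟨⟨0, Nat.pos_of_ne_zero hn0⟩⟩
  have hn2 : 2 * γ < n := by linarith
  have hΓα : 0 < Real.Gamma (((n : ℝ) + 2 * γ) / 2) := Real.Gamma_pos_of_pos (by linarith)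
  have hΓβ : 0 < Real.Gamma (((n : ℝ) - 2 * γ) / 2) := Real.Gamma_pos_of_pos (by linarith)
  have hΓγ : 0 < Real.Gamma γ := Real.Gamma_pos_of_pos hγ0
  have hΓn : 0 < Real.Gamma ((n : ℝ) / 2) := Real.Gamma_pos_of_pos (by linarith)
  have hpng : 0 < png n γ := by unfold png; positivity
  have hcng := cng_pos hγ0 hn2
  have hM := besselMoment_pos (p := 1 - γ) (μ := γ) (ν := γ) (by linarith) (by linarith)
    (by linarith) (by linarith)
  have hN := besselMoment_pos (p := (n : ℝ) / 2 - 1 + γ) (μ := -γ) (ν := -γ) (by linarith)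
    (by linarith) (by linarith) (by linarith)
  have hS : 0 < sphereConst n := by unfold sphereConst; positivity
  have hV := measurable_poissonBubble n γ
  have hW := measurable_bubbleExt n γ
  have hH := lintegral_lintegral_poissonBubble_sq hγ0 hγ1 (show 2 * γ + 4 < n by linarith)
  have h1 : (0 : ℝ) < n - 4 := by linarith
  have h2 : (0 : ℝ) < n - 2 * γ - 4 := by linarith
  have h3 : (0 : ℝ) < n + 2 * γ - 4 := by linarith
  have hpow : (2 : ℝ) ^ (1 - 2 * γ) * 2 ^ ((n : ℝ) - 5) *
      (2 ^ (1 - ((n : ℝ) - 2 * γ) / 2)) ^ 2 = 1 / 4 := by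
    rw [← Real.rpow_mul_natCast (by norm_num), ← Real.rpow_add (by norm_num),
      ← Real.rpow_add (by norm_num), show (1 / 4 : ℝ) = 2 ^ (-2 : ℝ) by
        rw [Real.rpow_neg (by norm_num)]; norm_num]
    congr 1; push_cast; ring
  have hconst : sphereConst n *
        ((n : ℝ) * (3 * ((n : ℝ) - 3) ^ 2 + (1 - 4 * γ ^ 2)) /
          (3 * ((n : ℝ) - 4) * ((n : ℝ) - 2 * γ - 4) * ((n : ℝ) + 2 * γ - 4))) *
        (Aone γ * Btwo n γ) = png n γ ^ 2 * ((cng n γ * Real.pi ^ ((n : ℝ) / 2) /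
        (Real.Gamma (((n : ℝ) + 2 * γ) / 2) * Real.Gamma (((n : ℝ) - 2 * γ) / 2))) ^ 2 *
          (sphereConst n / 2) * ((n : ℝ) / 2 * (3 * ((n : ℝ) / 2) ^ 2 - 9 * ((n : ℝ) / 2) + 7 -
            γ ^ 2) / (6 * ((n : ℝ) / 2 - 2) * ((n : ℝ) / 2 - 2 - γ) * ((n : ℝ) / 2 - 2 + γ)) *
        besselMoment (1 - γ) γ γ * besselMoment ((n : ℝ) / 2 - 1 + γ) (-γ) (-γ))) := by
    rw [Aone_eq hγ0 hγ1, Btwo_eq hγ0 (by linarith), dTwo_eq hγ0 hn2, png,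
      show (n : ℝ) / 2 - 2 = (n - 4) / 2 by ring,
      show ((n : ℝ) - 4) / 2 - γ = (n - 2 * γ - 4) / 2 by ring,
      show ((n : ℝ) - 4) / 2 + γ = (n + 2 * γ - 4) / 2 by ring]
    trans sphereConst n * ((n : ℝ) * (3 * ((n : ℝ) - 3) ^ 2 + (1 - 4 * γ ^ 2)) /
      (3 * ((n : ℝ) - 4) * ((n : ℝ) - 2 * γ - 4) * ((n : ℝ) + 2 * γ - 4))) *
      ((2 : ℝ) ^ (1 - 2 * γ) * 2 ^ ((n : ℝ) - 5) * (2 ^ (1 - ((n : ℝ) - 2 * γ) / 2)) ^ 2) *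
      (cng n γ / (Real.Gamma γ * Real.Gamma (((n : ℝ) - 2 * γ) / 2))) ^ 2 *
      besselMoment (1 - γ) γ γ * besselMoment ((n : ℝ) / 2 - 1 + γ) (-γ) (-γ)
    · ring
    · rw [hpow]
      field_simp
      ring
  have hfin : ∀ᵐ y ∂(volume.restrict (Set.Ioi (0 : ℝ))),
      ∀ᵐ x : EuclideanSpace ℝ (Fin n), poissonBubble n γ y x ≠ ⊤ := by
    have hm : Measurable fun p : ℝ × EuclideanSpace ℝ (Fin n) =>
        ENNReal.ofReal (p.1 ^ (1 - 2 * γ)) * (ENNReal.ofReal (‖p.2‖ ^ 2) *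
          poissonBubble n γ p.1 p.2 ^ 2) := by
      have : Measurable fun p : ℝ × EuclideanSpace ℝ (Fin n) => poissonBubble n γ p.1 p.2 := hV
      fun_prop
    filter_upwards [ae_lt_top hm.lintegral_prod_right' (by
      rw [hH]; exact ENNReal.ofReal_ne_top), ae_restrict_mem measurableSet_Ioi] with y hy hy0
    have hy0 : 0 < y := hy0
    filter_upwards [ae_lt_top (hm.comp measurable_prodMk_left) hy.ne,
      Measure.ae_ne volume (0 : EuclideanSpace ℝ (Fin n))] with x hx hx0 hxV
    simp only [Function.comp_apply] at hx
    rw [hxV, ENNReal.top_pow two_ne_zero,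
      ENNReal.mul_top (by simpa using hx0),
      ENNReal.mul_top (by simpa using Real.rpow_pos_of_pos hy0 _)] at hx
    exact hx.ne rfl
  refine integral_integral_eq_of_lintegral_lintegral_eq (by
    unfold Function.uncurry; fun_prop) ?_ ?_ ?_
  · filter_upwards [ae_restrict_mem measurableSet_Ioi] with y hy x
    have hy : 0 < y := hy
    positivity
  · rw [Aone_eq hγ0 hγ1, Btwo_eq hγ0 (by linarith)]
    have h4 : 0 < 3 * ((n : ℝ) - 3) ^ 2 + (1 - 4 * γ ^ 2) := by nlinarith
    positivity
  · rw [hconst, ENNReal.ofReal_mul (by positivity), ← hH, ← lintegral_const_mul' _ _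
      ENNReal.ofReal_ne_top]
    refine lintegral_congr_ae ?_
    filter_upwards [hfin, ae_restrict_mem measurableSet_Ioi] with y hy hy0
    have hy0 : 0 < y := hy0
    rw [← lintegral_const_mul' _ _ ENNReal.ofReal_ne_top]
    refine lintegral_congr_ae ?_
    filter_upwards [hy] with x hx
    rw [bubbleExt_eq_toReal hγ0 hn2 hy0, mul_pow, ENNReal.ofReal_mul (by positivity),
      ENNReal.ofReal_mul (by positivity), ENNReal.ofReal_mul (by positivity),
      ENNReal.ofReal_pow ENNReal.toReal_nonneg, ENNReal.ofReal_toReal hx]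
    ring

end
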